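/- Let q:[0,T]×ℝⁿ→ℝ^o be continuous, let φ ∈ H, and let φ_i ∈ H_i satisfy ‖φ_i − φ‖_H → 0 as i → ∞. For each i and each k with 0 ≤ k < N_i, pick an interpolation node τ_{k,i} ∈ [t_{k,i}, t_{k+1,i}], and define g_i:[0,T]→ℝ^o as the piecewise constant function with g_i(t) = q(τ_{k,i}, φ_i(τ_{k,i})) for t ∈ [t_{k,i}, t_{k+1,i}) (and g_i(T) = q(τ_{N_i−1,i}, φ_i(τ_{N_i−1,i}))); define g(t) := q(t, φ(t)). Then sup_i sup_{t∈[0,T]}‖g_i(t)‖ < ∞, sup_{t∈[0,T]}‖g(t)‖ < ∞, and lim_{i→∞} sup_{t∈[0,T]}‖g(t) − g_i(t)‖ = 0. -/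

import Mathlib

open MeasureTheory Set Filter

noncomputable section

/-- `φ` belongs to the Cameron–Martin space `H` on `[0,T]`, with a.e. derivative `φ'`:
`φ` is absolutely continuous with (integrable) derivative `φ'` which is square integrable. -/
def IsCM {n : ℕ} (T : ℝ) (φ φ' : ℝ → EuclideanSpace ℝ (Fin n)) : Prop :=
  IntervalIntegrable φ' volume 0 T ∧
  (∀ t ∈ Icc (0 : ℝ) T, φ t = φ 0 + ∫ s in (0 : ℝ)..t, φ' s) ∧
  IntervalIntegrable (fun s => ‖φ' s‖ ^ 2) volume 0 T

/-- Square of the Cameron–Martin norm `‖φ‖_H² = ‖φ(0)‖² + ∫₀ᵀ ‖φ̇(t)‖² dt`. -/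
def cmNormSq {n : ℕ} (T : ℝ) (φ φ' : ℝ → EuclideanSpace ℝ (Fin n)) : ℝ :=
  ‖φ 0‖ ^ 2 + ∫ s in (0 : ℝ)..T, ‖φ' s‖ ^ 2

/-- Mesh `δ̄ᵢ` of the `i`-th partition: the largest increment. -/
def mesh (tt : ℕ → ℕ → ℝ) (N : ℕ → ℕ) (i : ℕ) : ℝ :=
  ⨆ k : Fin (N i), (tt i (k + 1) - tt i k)

/-- `ψ` is piecewise linear (affine on each cell) w.r.t. the partition points
`tt 0 < … < tt N`. -/
def IsPL {n : ℕ} (tt : ℕ → ℝ) (N : ℕ) (ψ : ℝ → EuclideanSpace ℝ (Fin n)) : Prop :=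
  ∀ k < N, ∀ s ∈ Icc (tt k) (tt (k + 1)),
    ψ s = ψ (tt k) + ((s - tt k) / (tt (k + 1) - tt k)) • (ψ (tt (k + 1)) - ψ (tt k))

/-- `ψ'` is the (piecewise constant) slope derivative of the piecewise linear `ψ`. -/
def IsPLDeriv {n : ℕ} (tt : ℕ → ℝ) (N : ℕ) (ψ ψ' : ℝ → EuclideanSpace ℝ (Fin n)) : Prop :=
  ∀ k < N, ∀ s ∈ Ico (tt k) (tt (k + 1)),
    ψ' s = (tt (k + 1) - tt k)⁻¹ • (ψ (tt (k + 1)) - ψ (tt k))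

/-- A nested sequence of partitions `Pᵢ = {0 = tᵢ₀ < … < tᵢ_{Nᵢ} = T}` of `[0, T]`
with mesh tending to zero. -/
structure NestedPartitions (T : ℝ) (tt : ℕ → ℕ → ℝ) (N : ℕ → ℕ) : Prop where
  npos : ∀ i, 0 < N i
  zero : ∀ i, tt i 0 = 0
  last : ∀ i, tt i (N i) = T
  mono : ∀ i, ∀ k < N i, tt i k < tt i (k + 1)
  nested : ∀ i, ∀ k ≤ N i, ∃ l ≤ N (i + 1), tt (i + 1) l = tt i k
  meshZero : Tendsto (mesh tt N) atTop (nhds 0)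

lemma IsCM.continuousOn {n : ℕ} {T : ℝ} (hT : 0 ≤ T) {φ φ' : ℝ → EuclideanSpace ℝ (Fin n)}
    (h : IsCM T φ φ') : ContinuousOn φ (Icc 0 T) := by
  obtain ⟨hi, he, -⟩ := h
  have hc := intervalIntegral.continuousOn_primitive_interval' hi left_mem_uIcc
  rw [uIcc_of_le hT] at hc
  exact (continuousOn_const.add hc).congr he

/-- The difference of two Cameron–Martin functions is a Cameron–Martin function. -/
lemma IsCM.sub {n : ℕ} {T : ℝ} (hT : 0 ≤ T) {φ φ' ψ ψ' : ℝ → EuclideanSpace ℝ (Fin n)}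
    (hφ : IsCM T φ φ') (hψ : IsCM T ψ ψ') :
    IsCM T (fun s => φ s - ψ s) (fun s => φ' s - ψ' s) := by
  obtain ⟨h1, h2, h3⟩ := hφ
  obtain ⟨k1, k2, k3⟩ := hψ
  refine ⟨h1.sub k1, fun t ht => ?_, ?_⟩
  · beta_reduce
    have hsub : uIcc 0 t ⊆ uIcc 0 T := by
      rw [uIcc_of_le ht.1, uIcc_of_le hT]
      exact Icc_subset_Icc_right ht.2
    rw [intervalIntegral.integral_sub (h1.mono_set hsub) (k1.mono_set hsub), h2 t ht, k2 t ht]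
    abel
  · refine ((h3.const_mul 2).add (k3.const_mul 2)).mono_fun ?_ (ae_of_all _ fun s => ?_)
    · exact (intervalIntegrable_iff.1 (h1.sub k1)).aestronglyMeasurable.norm.pow 2
    · beta_reduce
      rw [Real.norm_of_nonneg (by positivity), Real.norm_of_nonneg (by positivity)]
      have := norm_sub_le (φ' s) (ψ' s)
      nlinarith [sq_nonneg (‖φ' s‖ - ‖ψ' s‖), norm_nonneg (φ' s - ψ' s)]

/-- The Cameron–Martin norm controls the uniform norm on `[0, T]`. -/
lemma IsCM.norm_le {n : ℕ} {T : ℝ} (hT : 0 ≤ T) {φ φ' : ℝ → EuclideanSpace ℝ (Fin n)}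
    (h : IsCM T φ φ') {ε : ℝ} (hε : 0 < ε) (hlt : Real.sqrt (cmNormSq T φ φ') < ε)
    {t : ℝ} (ht : t ∈ Icc 0 T) : ‖φ t‖ ≤ (T + 3) * ε := by
  obtain ⟨h1, h2, h3⟩ := h
  have hsq : ‖φ 0‖ ^ 2 + ∫ s in (0 : ℝ)..T, ‖φ' s‖ ^ 2 < ε ^ 2 := (Real.sqrt_lt' hε).1 hlt
  have hI : 0 ≤ ∫ s in (0 : ℝ)..T, ‖φ' s‖ ^ 2 :=
    intervalIntegral.integral_nonneg hT fun s _ => by positivity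
  have h0 : ‖φ 0‖ ≤ ε := (sq_le_sq₀ (norm_nonneg _) hε.le).1 (by linarith)
  have hle : ∫ s in (0 : ℝ)..T, ‖φ' s‖ ≤ ∫ s in (0 : ℝ)..T, (ε + ε⁻¹ * ‖φ' s‖ ^ 2) := by
    refine intervalIntegral.integral_mono_on hT h1.norm
      (intervalIntegrable_const.add (h3.const_mul _)) fun s _ => ?_
    rw [← sub_nonneg]
    have : ε + ε⁻¹ * ‖φ' s‖ ^ 2 - ‖φ' s‖
        = ε⁻¹ * ((ε - ‖φ' s‖ / 2) ^ 2 + 3 / 4 * ‖φ' s‖ ^ 2) := by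
      field_simp
      ring
    rw [this]
    positivity
  rw [intervalIntegral.integral_add intervalIntegrable_const (h3.const_mul _),
    intervalIntegral.integral_const_mul, intervalIntegral.integral_const, smul_eq_mul] at hle
  have hε' : ε⁻¹ * ∫ s in (0 : ℝ)..T, ‖φ' s‖ ^ 2 ≤ ε := by
    rw [inv_mul_le_iff₀ hε]
    nlinarith [sq_nonneg ‖φ 0‖]
  have hint : ‖∫ s in (0 : ℝ)..t, φ' s‖ ≤ ∫ s in (0 : ℝ)..T, ‖φ' s‖ :=
    (intervalIntegral.norm_integral_le_integral_norm ht.1).trans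
      (intervalIntegral.integral_mono_interval le_rfl ht.1 ht.2
        (ae_of_all _ fun s => norm_nonneg _) h1.norm)
  rw [h2 t ht]
  linarith [norm_add_le (φ 0) (∫ s in (0 : ℝ)..t, φ' s)]

lemma NestedPartitions.mem_Icc {T : ℝ} {tt : ℕ → ℕ → ℝ} {N : ℕ → ℕ}
    (h : NestedPartitions T tt N) (i : ℕ) {k : ℕ} (hk : k ≤ N i) : tt i k ∈ Icc 0 T := by
  have hmono : MonotoneOn (tt i) (Iic (N i)) :=
    monotoneOn_of_le_succ ordConnected_Iic fun a _ _ ha => (h.mono i a ha).le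
  exact ⟨h.zero i ▸ hmono (Nat.zero_le _) hk (Nat.zero_le _),
    h.last i ▸ hmono hk (le_refl (N i)) hk⟩

lemma sub_le_mesh {tt : ℕ → ℕ → ℝ} {N : ℕ → ℕ} (i : ℕ) {k : ℕ}
    (hk : k < N i) : tt i (k + 1) - tt i k ≤ mesh tt N i :=
  le_ciSup (f := fun k : Fin (N i) => tt i (k + 1) - tt i k)
    (Set.finite_range _).bddAbove ⟨k, hk⟩

/-- Every point of `[0, T)` lies in a half-open cell of the partition. -/
lemma NestedPartitions.exists_mem_Ico {T : ℝ} {tt : ℕ → ℕ → ℝ} {N : ℕ → ℕ}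
    (h : NestedPartitions T tt N) (i : ℕ) {s : ℝ} (hs : s ∈ Ico 0 T) :
    ∃ k < N i, s ∈ Ico (tt i k) (tt i (k + 1)) := by
  by_contra! hcon
  have hle : ∀ k ≤ N i, tt i k ≤ s := by
    intro k
    induction k with
    | zero => intro _; rw [h.zero]; exact hs.1
    | succ k ih =>
      intro hk
      by_contra! hlt
      exact hcon k hk ⟨ih (by omega), hlt⟩
  exact absurd (hle _ le_rfl) (by rw [h.last]; exact not_le.2 hs.2)

/-- Convergence of piecewise constant interpolates: if `q` is continuous, `φᵢ ∈ Hᵢ` are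
piecewise linear and converge to `φ` in the Cameron–Martin norm, and `gᵢ` is the piecewise
constant interpolation of `q(·, φᵢ(·))` at nodes `τᵢₖ ∈ [tᵢₖ, tᵢ,ₖ₊₁]`, then the `gᵢ` and
`g = q(·, φ(·))` are (uniformly) bounded on `[0,T]` and `gᵢ → g` uniformly on `[0,T]`. -/
theorem piecewise_constant_interpolates_converge {n o : ℕ} (T : ℝ) (hT : 0 < T)
    (tt : ℕ → ℕ → ℝ) (N : ℕ → ℕ) (hpart : NestedPartitions T tt N)
    (q : ℝ → EuclideanSpace ℝ (Fin n) → EuclideanSpace ℝ (Fin o))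
    (hq : Continuous fun p : ℝ × EuclideanSpace ℝ (Fin n) => q p.1 p.2)
    (φ φ' : ℝ → EuclideanSpace ℝ (Fin n)) (hφ : IsCM T φ φ')
    (Φ Φ' : ℕ → ℝ → EuclideanSpace ℝ (Fin n))
    (hpl : ∀ i, IsPL (tt i) (N i) (Φ i))
    (hpld : ∀ i, IsPLDeriv (tt i) (N i) (Φ i) (Φ' i))
    (hcm : ∀ i, IsCM T (Φ i) (Φ' i))
    (hconv : Tendsto (fun i => Real.sqrt (cmNormSq T (fun s => Φ i s - φ s)
      (fun s => Φ' i s - φ' s))) atTop (nhds 0))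
    (τ : ℕ → ℕ → ℝ)
    (hτ : ∀ i, ∀ k < N i, τ i k ∈ Icc (tt i k) (tt i (k + 1)))
    (g : ℕ → ℝ → EuclideanSpace ℝ (Fin o))
    (hg : ∀ i, ∀ k < N i, ∀ s ∈ Ico (tt i k) (tt i (k + 1)),
      g i s = q (τ i k) (Φ i (τ i k)))
    (hgT : ∀ i, g i T = q (τ i (N i - 1)) (Φ i (τ i (N i - 1)))) :
    (∃ C : ℝ, ∀ i, ∀ s ∈ Icc (0 : ℝ) T, ‖g i s‖ ≤ C) ∧
    (∃ C : ℝ, ∀ s ∈ Icc (0 : ℝ) T, ‖q s (φ s)‖ ≤ C) ∧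
    Tendsto (fun i => ⨆ s : Icc (0 : ℝ) T, ‖q (s : ℝ) (φ s) - g i s‖) atTop (nhds 0) := by
  have hφc := hφ.continuousOn hT.le
  have hcell : ∀ i, ∀ s ∈ Icc (0 : ℝ) T, ∃ k < N i, τ i k ∈ Icc (0 : ℝ) T ∧
      dist s (τ i k) ≤ mesh tt N i ∧ g i s = q (τ i k) (Φ i (τ i k)) := by
    intro i s hs
    obtain ⟨k, hk, hsk, hgs⟩ : ∃ k < N i, s ∈ Icc (tt i k) (tt i (k + 1)) ∧
        g i s = q (τ i k) (Φ i (τ i k)) := by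
      rcases hs.2.eq_or_lt with rfl | hlt
      · have hN := hpart.npos i
        have hsucc : N i - 1 + 1 = N i := by omega
        refine ⟨N i - 1, by omega, ⟨(hpart.mem_Icc i (by omega)).2, ?_⟩, hgT i⟩
        rw [hsucc, hpart.last]
      · obtain ⟨k, hk, hsk⟩ := hpart.exists_mem_Ico i ⟨hs.1, hlt⟩
        exact ⟨k, hk, Ico_subset_Icc_self hsk, hg i k hk s hsk⟩
    have hτk := hτ i k hk
    refine ⟨k, hk, ⟨(hpart.mem_Icc i hk.le).1.trans hτk.1,
      hτk.2.trans (hpart.mem_Icc i hk).2⟩, ?_, hgs⟩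
    exact (Real.dist_le_of_mem_Icc hsk hτk).trans (sub_le_mesh i hk)
  have hunif : ∀ ε > 0, ∀ᶠ i in atTop, ∀ s ∈ Icc (0 : ℝ) T, dist (Φ i s) (φ s) ≤ ε := by
    intro ε hε
    have hε' : 0 < ε / (T + 3) := by positivity
    filter_upwards [hconv.eventually_lt_const hε'] with i hi s hs
    rw [dist_eq_norm]
    refine (((hcm i).sub hT.le hφ).norm_le hT.le hε' hi hs).trans_eq ?_
    field_simp
  have hK : IsCompact (Icc (0 : ℝ) T ×ˢ Metric.cthickening 1 (φ '' Icc 0 T)) :=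
    isCompact_Icc.prod (isCompact_Icc.image_of_continuousOn hφc).cthickening
  have hqu := Metric.uniformContinuousOn_iff.1 (hK.uniformContinuousOn_of_continuous hq.continuousOn)
  have hφu := Metric.uniformContinuousOn_iff.1
    (isCompact_Icc.uniformContinuousOn_of_continuous hφc)
  have hmain : ∀ ε > 0, ∀ᶠ i in atTop, ∀ s ∈ Icc (0 : ℝ) T, ‖q s (φ s) - g i s‖ ≤ ε := by
    intro ε hε
    obtain ⟨δ, hδ, hqδ⟩ := hqu ε hε
    obtain ⟨η, hη, hφη⟩ := hφu (δ / 2) (by positivity)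
    filter_upwards [hunif 1 one_pos, hunif (δ / 3) (by positivity),
      hpart.meshZero.eventually_lt_const (lt_min hδ hη)] with i h1 h2 h3 s hs
    obtain ⟨k, -, hτk, hd, hgs⟩ := hcell i s hs
    rw [hgs, ← dist_eq_norm]
    refine (hqδ (s, φ s) ⟨hs, Metric.self_subset_cthickening _ (mem_image_of_mem _ hs)⟩
      (τ i k, Φ i (τ i k)) ⟨hτk, ?_⟩ ?_).le
    · exact Metric.mem_cthickening_of_dist_le _ _ _ _ (mem_image_of_mem _ hτk) (h1 _ hτk)
    · have hd' := lt_min_iff.1 (hd.trans_lt h3)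
      rw [Prod.dist_eq]
      refine max_lt hd'.1 ?_
      have := hφη s hs (τ i k) hτk hd'.2
      have := h2 _ hτk
      rw [dist_comm] at this
      linarith [dist_triangle (φ s) (φ (τ i k)) (Φ i (τ i k))]
  obtain ⟨C, hC⟩ := isCompact_Icc.exists_bound_of_continuousOn
    (hq.comp_continuousOn (continuousOn_id.prodMk hφc))
  simp only [Function.comp_apply, id] at hC
  refine ⟨?_, ⟨C, hC⟩, ?_⟩
  · obtain ⟨I, hI⟩ := eventually_atTop.1 (hmain 1 one_pos)
    let B : ℕ → ℝ := fun i => ∑ k ∈ Finset.range (N i), ‖q (τ i k) (Φ i (τ i k))‖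
    have hB0 : ∀ i, 0 ≤ B i := fun i => Finset.sum_nonneg fun _ _ => norm_nonneg _
    refine ⟨max (C + 1) (∑ i ∈ Finset.range I, B i), fun i s hs => ?_⟩
    rcases le_or_gt I i with hi | hi
    · refine le_max_of_le_left ?_
      have h1 := hI i hi s hs
      rw [norm_sub_rev] at h1
      linarith [norm_le_norm_add_norm_sub' (g i s) (q s (φ s)), hC s hs]
    · refine le_max_of_le_right ?_
      obtain ⟨k, hk, -, -, hgs⟩ := hcell i s hs
      rw [hgs]
      exact (Finset.single_le_sum (f := fun k => ‖q (τ i k) (Φ i (τ i k))‖)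
        (fun _ _ => norm_nonneg _) (Finset.mem_range.2 hk)).trans
        (Finset.single_le_sum (fun i _ => hB0 i) (Finset.mem_range.2 hi))
  · rw [Metric.tendsto_nhds]
    intro ε hε
    filter_upwards [hmain (ε / 2) (half_pos hε)] with i hi
    rw [Real.dist_0_eq_abs, abs_of_nonneg (Real.iSup_nonneg fun _ => norm_nonneg _)]
    exact (Real.iSup_le (fun s : Icc (0 : ℝ) T => hi s s.2) (half_pos hε).le).trans_lt (half_lt_self hε)
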